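/- arXiv:0710.2731 — 6 statements merged into one kernel-verified Lean document; each statement's English description precedes it below -/
import Mathlib

section
/- Forward action of the usual equivalence group G~ (Theorem on G~): Let δ1, δ2, δ3, δ4, ε1, ε2, ε3 be real constants with δ1·δ3·ε1·ε2·ε3 ≠ 0, and let X : ℝ → ℝ be smooth with X'(x) ≠ 0 for all x. Let f, g, h : ℝ → ℝ be C¹ and A, B : ℝ → ℝ be C¹, and let f̃, g̃, h̃, Ã, B̃ be functions satisfying f̃(X(x)) = ε1·δ1·f(x)/X'(x), g̃(X(x)) = ε1·ε2⁻¹·X'(x)·g(x), h̃(X(x)) = ε1·ε3⁻¹·h(x) for all x, and Ã(δ3·v+δ4) = ε2·A(v), B̃(δ3·v+δ4) = ε3·B(v) for all v. If u : ℝ×ℝ → ℝ is a C² solution of f(x)u_t = (g(x)A(u)u_x)_x + h(x)B(u)u_x and ũ is a C² function satisfying ũ(δ1·t+δ2, X(x)) = δ3·u(t,x)+δ4 for all (t,x), then ũ satisfies f̃(x̃)ũ_t̃ = (g̃(x̃)Ã(ũ)ũ_x̃)_x̃ + h̃(x̃)B̃(ũ)ũ_x̃ at every point of the form (t̃,x̃)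 = (δ1·t+δ2, X(x)). -/
/-- Chain rule through a locally invertible change of variable. -/
theorem hasDerivAt_of_comp_eq {X G F : ℝ → ℝ} {x X' F' : ℝ} (hX : HasStrictDerivAt X X' x)
    (h0 : X' ≠ 0) (hF : HasDerivAt F F' x) (hG : ∀ y, G (X y) = F y) :
    HasDerivAt G (F' * X'⁻¹) (X x) := by
  have hinv := (hX.to_localInverse h0).hasDerivAt
  have hr := (hX.hasStrictFDerivAt_equiv h0).eventually_right_inverse
  have hx : hX.localInverse X X' x h0 (X x) = x :=
    (hX.hasStrictFDerivAt_equiv h0).localInverse_apply_image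
  have hc : HasDerivAt (F ∘ hX.localInverse X X' x h0) (F' * X'⁻¹) (X x) := by
    apply HasDerivAt.comp _ _ hinv
    rw [hx]; exact hF
  apply hc.congr_of_eventuallyEq
  filter_upwards [hr] with y hy
  have := hG (hX.localInverse X X' x h0 y)
  simp only [Function.comp]
  rw [← this]
  exact congrArg G hy.symm

/-- Forward action of the usual equivalence group `G~` on solutions of
`f(x) u_t = (g(x) A(u) u_x)_x + h(x) B(u) u_x`. -/
theorem usual_equivalence_group_action
    (δ1 δ2 δ3 δ4 ε1 ε2 ε3 : ℝ)
    (hconst : δ1 * δ3 * ε1 * ε2 * ε3 ≠ 0)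
    (X : ℝ → ℝ) (hX : ContDiff ℝ (⊤ : ℕ∞) X) (hX' : ∀ x, deriv X x ≠ 0)
    (f g h A B : ℝ → ℝ)
    (hf : ContDiff ℝ 1 f) (hg : ContDiff ℝ 1 g) (hh : ContDiff ℝ 1 h)
    (hA : ContDiff ℝ 1 A) (hB : ContDiff ℝ 1 B)
    (ft gt ht At Bt : ℝ → ℝ)
    (hft : ∀ x, ft (X x) = ε1 * δ1 * f x / deriv X x)
    (hgt : ∀ x, gt (X x) = ε1 * ε2⁻¹ * deriv X x * g x)
    (hht : ∀ x, ht (X x) = ε1 * ε3⁻¹ * h x)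
    (hAt : ∀ v, At (δ3 * v + δ4) = ε2 * A v)
    (hBt : ∀ v, Bt (δ3 * v + δ4) = ε3 * B v)
    (u : ℝ → ℝ → ℝ) (hu : ContDiff ℝ 2 (fun p : ℝ × ℝ => u p.1 p.2))
    (hsol : ∀ t x,
      f x * deriv (fun s => u s x) t =
        deriv (fun y => g y * A (u t y) * deriv (fun z => u t z) y) x
          + h x * B (u t x) * deriv (fun y => u t y) x)
    (ut : ℝ → ℝ → ℝ) (hut : ContDiff ℝ 2 (fun p : ℝ × ℝ => ut p.1 p.2))
    (hrel : ∀ t x, ut (δ1 * t + δ2) (X x) = δ3 * u t x + δ4) :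
    ∀ t x,
      ft (X x) * deriv (fun s => ut s (X x)) (δ1 * t + δ2) =
        deriv (fun y => gt y * At (ut (δ1 * t + δ2) y)
            * deriv (fun z => ut (δ1 * t + δ2) z) y) (X x)
          + ht (X x) * Bt (ut (δ1 * t + δ2) (X x))
            * deriv (fun y => ut (δ1 * t + δ2) y) (X x) := by
  intro t x
  have hne : δ1 ≠ 0 ∧ δ3 ≠ 0 ∧ ε1 ≠ 0 ∧ ε2 ≠ 0 ∧ ε3 ≠ 0 := by
    simp only [mul_ne_zero_iff] at hconst
    tauto
  obtain ⟨h1, h3, he1, he2, he3⟩ := hne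
  have hXs : ∀ y, HasStrictDerivAt X (deriv X y) y := fun y =>
    (hX.contDiffAt).hasStrictDerivAt (by simp)
  have hux : ContDiff ℝ 2 (fun y => u t y) :=
    hu.comp (contDiff_const.prodMk contDiff_id)
  have hut' : ContDiff ℝ 2 (fun s => u s x) :=
    hu.comp (contDiff_id.prodMk contDiff_const)
  have hux1 : Differentiable ℝ (fun y => u t y) := hux.differentiable (by simp)
  have hux2 : Differentiable ℝ (deriv (fun y => u t y)) :=
    ((contDiff_succ_iff_deriv (n := 1)).1 (by simpa [one_add_one_eq_two] using hux)).2.2.differentiable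
      (by simp)
  have hdx : ∀ y, deriv (fun z => ut (δ1 * t + δ2) z) (X y)
      = δ3 * deriv (fun z => u t z) y * (deriv X y)⁻¹ := fun y =>
    (hasDerivAt_of_comp_eq (hXs y) (hX' y)
      (((hux1 y).hasDerivAt.const_mul δ3).add_const δ4) (fun z => hrel t z)).deriv
  have hdt : deriv (fun s => ut s (X x)) (δ1 * t + δ2)
      = δ3 * deriv (fun s => u s x) t * δ1⁻¹ := by
    have hlin : HasStrictDerivAt (fun s : ℝ => δ1 * s + δ2) δ1 t := by
      simpa using ((hasStrictDerivAt_id t).const_mul δ1).add_const δ2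
    exact (hasDerivAt_of_comp_eq (G := fun s => ut s (X x)) hlin h1
      ((((hut'.differentiable (by simp)) t).hasDerivAt.const_mul δ3).add_const δ4)
      (fun z => hrel z x)).deriv
  have hFd : DifferentiableAt ℝ
      (fun y => g y * A (u t y) * deriv (fun z => u t z) y) x := by
    have hgd := hg.differentiable (by simp)
    have hAd := hA.differentiable (by simp)
    exact ((hgd x).mul ((hAd _).comp x (hux1 x))).mul (hux2 x)
  have hflux := (hasDerivAt_of_comp_eq
    (G := fun y => gt y * At (ut (δ1 * t + δ2) y) * deriv (fun z => ut (δ1 * t + δ2) z) y)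
    (hXs x) (hX' x) (hFd.hasDerivAt.const_mul (ε1 * δ3)) (fun y => by
      have := hX' y
      simp only [hdx, hgt, hrel, hAt]
      field_simp)).deriv
  have hs := hsol t x
  have hx0 := hX' x
  rw [hflux, hdt, hdx, hft, hht, hrel, hBt]
  generalize deriv (fun y => g y * A (u t y) * deriv (fun z => u t z) y) x = D at hs ⊢
  have hD : D = f x * deriv (fun s => u s x) t - h x * B (u t x) * deriv (fun y => u t y) x := by
    linarith
  rw [hD]
  field_simp
  ring
end

section
/- Forward action of the extended equivalence group Ĝ~ (Theorem on Ĝ~): Let δ1, δ2, δ3, δ4, ε1, ε2, ε3, ε4 be real constants with δ1·δ3·ε1·ε2·ε3 ≠ 0, let X : ℝ → ℝ be smooth with X'(x) ≠ 0 for all x, let g be nonvanishing, and let L : ℝ → ℝ be a C¹ function with L'(x) = h(x)/g(x); set φ(x) = exp(−ε4·L(x)). Let f̃, g̃, h̃, Ã, B̃ satisfy f̃(X(x)) = ε1·δ1·φ(x)·f(x)/X'(x), g̃(X(x)) = ε1·ε2⁻¹·X'(x)·φ(x)·g(x), h̃(X(x)) = ε1·ε3⁻¹·φ(x)·h(x)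 for all x, and Ã(δ3·v+δ4) = ε2·A(v), B̃(δ3·v+δ4) = ε3·(B(v) + ε4·A(v)) for all v. If u : ℝ×ℝ → ℝ is a C² solution of f(x)u_t = (g(x)A(u)u_x)_x + h(x)B(u)u_x and ũ is a C² function satisfying ũ(δ1·t+δ2, X(x)) = δ3·u(t,x)+δ4 for all (t,x), then ũ satisfies f̃(x̃)ũ_t̃ = (g̃(x̃)Ã(ũ)ũ_x̃)_x̃ + h̃(x̃)B̃(ũ)ũ_x̃ at every point (t̃,x̃) = (δ1·t+δ2, X(x)). -/
lemma hasDerivAt_of_comp_aux (F G X : ℝ → ℝ) (a x' g' : ℝ) (hX : HasStrictDerivAt X x' a)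
    (hx' : x' ≠ 0) (hFG : ∀ y, F (X y) = G y) (hG : HasDerivAt G g' a) :
    HasDerivAt F (g' * x'⁻¹) (X a) := by
  have h1 := (hX.to_localInverse hx').hasDerivAt
  have h2 := hX.eventually_right_inverse hx'
  have h3 : hX.localInverse X x' a hx' (X a) = a := HasStrictFDerivAt.localInverse_apply_image _
  have h4 : HasDerivAt (G ∘ hX.localInverse X x' a hx') (g' * x'⁻¹) (X a) :=
    HasDerivAt.comp (X a) (by rw [h3]; exact hG) h1
  refine h4.congr_of_eventuallyEq ?_
  filter_upwards [h2] with y hy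
  rw [Function.comp_apply, ← hFG, hy]

/-- Forward action of the extended equivalence group `Ĝ~` on solutions of
`f(x) u_t = (g(x) A(u) u_x)_x + h(x) B(u) u_x`, involving the nonlocal factor
`φ(x) = exp(-ε4 ∫ h/g dx)`. -/
theorem extended_equivalence_group_action
    (δ1 δ2 δ3 δ4 ε1 ε2 ε3 ε4 : ℝ)
    (hconst : δ1 * δ3 * ε1 * ε2 * ε3 ≠ 0)
    (X : ℝ → ℝ) (hX : ContDiff ℝ (⊤ : ℕ∞) X) (hX' : ∀ x, deriv X x ≠ 0)
    (f g h A B : ℝ → ℝ)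
    (hf : ContDiff ℝ 1 f) (hg : ContDiff ℝ 1 g) (hh : ContDiff ℝ 1 h)
    (hA : ContDiff ℝ 1 A) (hB : ContDiff ℝ 1 B)
    (hg0 : ∀ x, g x ≠ 0)
    (L : ℝ → ℝ) (hL : ContDiff ℝ 1 L) (hL' : ∀ x, deriv L x = h x / g x)
    (φ : ℝ → ℝ) (hφ : ∀ x, φ x = Real.exp (-ε4 * L x))
    (ft gt ht At Bt : ℝ → ℝ)
    (hft : ∀ x, ft (X x) = ε1 * δ1 * φ x * f x / deriv X x)
    (hgt : ∀ x, gt (X x) = ε1 * ε2⁻¹ * deriv X x * φ x * g x)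
    (hht : ∀ x, ht (X x) = ε1 * ε3⁻¹ * φ x * h x)
    (hAt : ∀ v, At (δ3 * v + δ4) = ε2 * A v)
    (hBt : ∀ v, Bt (δ3 * v + δ4) = ε3 * (B v + ε4 * A v))
    (u : ℝ → ℝ → ℝ) (hu : ContDiff ℝ 2 (fun p : ℝ × ℝ => u p.1 p.2))
    (hsol : ∀ t x,
      f x * deriv (fun s => u s x) t =
        deriv (fun y => g y * A (u t y) * deriv (fun z => u t z) y) x
          + h x * B (u t x) * deriv (fun y => u t y) x)
    (ut : ℝ → ℝ → ℝ) (hut : ContDiff ℝ 2 (fun p : ℝ × ℝ => ut p.1 p.2))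
    (hrel : ∀ t x, ut (δ1 * t + δ2) (X x) = δ3 * u t x + δ4) :
    ∀ t x,
      ft (X x) * deriv (fun s => ut s (X x)) (δ1 * t + δ2) =
        deriv (fun y => gt y * At (ut (δ1 * t + δ2) y)
            * deriv (fun z => ut (δ1 * t + δ2) z) y) (X x)
          + ht (X x) * Bt (ut (δ1 * t + δ2) (X x))
            * deriv (fun y => ut (δ1 * t + δ2) y) (X x) := by
  intro t x
  have hδ1 : δ1 ≠ 0 := by rintro rfl; simp at hconst
  have hε2 : ε2 ≠ 0 := by rintro rfl; simp at hconst
  have hε3 : ε3 ≠ 0 := by rintro rfl; simp at hconst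
  have hXs : ∀ y, HasStrictDerivAt X (deriv X y) y := fun y =>
    (hX.contDiffAt).hasStrictDerivAt (by simp)
  have hut2 : ContDiff ℝ 2 (fun y => u t y) :=
    hu.comp (contDiff_const.prodMk contDiff_id)
  have hus : ContDiff ℝ 2 (fun s => u s x) :=
    hu.comp (contDiff_id.prodMk contDiff_const)
  have hux : ∀ y, HasDerivAt (fun y => u t y) (deriv (fun z => u t z) y) y := fun y =>
    (hut2.differentiable (by norm_num) y).hasDerivAt
  have hutime : HasDerivAt (fun s => u s x) (deriv (fun s => u s x) t) t :=
    (hus.differentiable (by norm_num) t).hasDerivAt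
  have hd : ContDiff ℝ 1 (deriv (fun z => u t z)) :=
    ((contDiff_succ_iff_deriv (n := 1)).1 (by simpa [one_add_one_eq_two] using hut2)).2.2
  -- space derivative of ut
  have e1 : ∀ y, deriv (fun z => ut (δ1 * t + δ2) z) (X y)
      = δ3 * deriv (fun z => u t z) y * (deriv X y)⁻¹ := fun y =>
    (hasDerivAt_of_comp_aux _ (fun y => δ3 * u t y + δ4) X y _ _ (hXs y) (hX' y)
      (fun y => hrel t y) (((hux y).const_mul δ3).add_const δ4)).deriv
  -- time derivative of ut
  have e2 : deriv (fun s => ut s (X x)) (δ1 * t + δ2)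
      = δ3 * deriv (fun s => u s x) t * δ1⁻¹ :=
    (hasDerivAt_of_comp_aux (fun s => ut s (X x)) (fun s => δ3 * u s x + δ4)
      (fun s => δ1 * s + δ2) t δ1 _
      (by simpa using ((hasStrictDerivAt_id t).const_mul δ1).add_const δ2) hδ1
      (fun s => hrel s x) ((hutime.const_mul δ3).add_const δ4)).deriv
  -- flux
  have hflux : HasDerivAt (fun y => g y * A (u t y) * deriv (fun z => u t z) y)
      (deriv (fun y => g y * A (u t y) * deriv (fun z => u t z) y) x) x := by
    apply DifferentiableAt.hasDerivAt
    have a1 := hg.differentiable (by norm_num) x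
    have a2 : DifferentiableAt ℝ (fun y => A (u t y)) x :=
      ((hA.differentiable (by norm_num)).comp (hut2.differentiable (by norm_num))) x
    have a3 := hd.differentiable (by norm_num) x
    exact (a1.mul a2).mul a3
  have hφd : HasDerivAt φ (φ x * (-ε4 * (h x / g x))) x := by
    have hLd : HasDerivAt L (h x / g x) x := by
      rw [← hL' x]; exact (hL.differentiable (by norm_num) x).hasDerivAt
    have := (hLd.const_mul (-ε4)).exp
    rw [← hφ x] at this
    exact this.congr_of_eventuallyEq (Filter.Eventually.of_forall hφ)
  have e3 := (hasDerivAt_of_comp_aux (fun y => gt y * At (ut (δ1 * t + δ2) y)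
            * deriv (fun z => ut (δ1 * t + δ2) z) y)
      (fun y => (ε1 * δ3) * (φ y * (g y * A (u t y) * deriv (fun z => u t z) y))) X x _ _
      (hXs x) (hX' x)
      (fun y => by
        have := hX' y
        simp only [e1, hrel, hAt, hgt]
        field_simp)
      ((hφd.mul hflux).const_mul (ε1 * δ3))).deriv
  rw [e3, e2, e1, hrel, hBt, hft, hht]
  have hs := hsol t x
  have h1 := hX' x
  have h2 := hg0 x
  generalize deriv (fun y => g y * A (u t y) * deriv (fun z => u t z) y) x = D at *
  have hD : D = f x * deriv (fun s => u s x) t - h x * B (u t x) * deriv (fun y => u t y) x := by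
    linarith
  rw [hD]
  field_simp
  ring
end

section
/- Gauge equivalence identity: Let ε1, ε2, ε3, ε4 be real constants with ε1·ε2·ε3 ≠ 0, let g be nonvanishing, and let L : ℝ → ℝ be a C¹ function with L'(x) = h(x)/g(x). Define f̃(x) = ε1·e^{−ε4 L(x)}·f(x), g̃(x) = ε1·ε2⁻¹·e^{−ε4 L(x)}·g(x), h̃(x) = ε1·ε3⁻¹·e^{−ε4 L(x)}·h(x), Ã(v) = ε2·A(v), B̃(v) = ε3·(B(v) + ε4·A(v)). Then for every C² function u : ℝ×ℝ → ℝ and every point (t,x): f̃(x)u_t − (g̃(x)Ã(u)u_x)_x − h̃(x)B̃(u)u_x = ε1·e^{−ε4 L(x)}·( f(x)u_t − (g(x)A(u)u_x)_x − h(x)B(u)u_x ). In particular, u solves f(x)u_t = (g(x)A(u)u_x)_x + h(x)B(u)u_x if and only if u solves f̃(x)u_t = (g̃(x)Ã(u)u_x)_x + h̃(x)B̃(u)u_x; i.e., the two tuples of arbitrary elements determine the same equation. -/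
/-- Gauge equivalence identity: the two tuples of arbitrary elements related by the
gauge transformation determine the same diffusion--convection equation. -/
theorem gauge_equivalence_identity
    (ε1 ε2 ε3 ε4 : ℝ) (hconst : ε1 * ε2 * ε3 ≠ 0)
    (f g h A B : ℝ → ℝ)
    (hf : ContDiff ℝ 1 f) (hg : ContDiff ℝ 1 g) (hh : ContDiff ℝ 1 h)
    (hA : ContDiff ℝ 1 A) (hB : ContDiff ℝ 1 B)
    (hg0 : ∀ x, g x ≠ 0)
    (L : ℝ → ℝ) (hL : ContDiff ℝ 1 L) (hL' : ∀ x, deriv L x = h x / g x)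
    (ft gt ht At Bt : ℝ → ℝ)
    (hft : ∀ x, ft x = ε1 * Real.exp (-ε4 * L x) * f x)
    (hgt : ∀ x, gt x = ε1 * ε2⁻¹ * Real.exp (-ε4 * L x) * g x)
    (hht : ∀ x, ht x = ε1 * ε3⁻¹ * Real.exp (-ε4 * L x) * h x)
    (hAt : ∀ v, At v = ε2 * A v)
    (hBt : ∀ v, Bt v = ε3 * (B v + ε4 * A v)) :
    ∀ u : ℝ → ℝ → ℝ, ContDiff ℝ 2 (fun p : ℝ × ℝ => u p.1 p.2) →
      ((∀ t x,
          ft x * deriv (fun s => u s x) t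
            - deriv (fun y => gt y * At (u t y) * deriv (fun z => u t z) y) x
            - ht x * Bt (u t x) * deriv (fun y => u t y) x
          = ε1 * Real.exp (-ε4 * L x) *
              (f x * deriv (fun s => u s x) t
                - deriv (fun y => g y * A (u t y) * deriv (fun z => u t z) y) x
                - h x * B (u t x) * deriv (fun y => u t y) x))
        ∧
        ((∀ t x,
            f x * deriv (fun s => u s x) t =
              deriv (fun y => g y * A (u t y) * deriv (fun z => u t z) y) x
                + h x * B (u t x) * deriv (fun y => u t y) x)
          ↔
          (∀ t x,
            ft x * deriv (fun s => u s x) t =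
              deriv (fun y => gt y * At (u t y) * deriv (fun z => u t z) y) x
                + ht x * Bt (u t x) * deriv (fun y => u t y) x))) := by
  intro u hu
  have h1 : ε1 ≠ 0 := fun h0 => hconst (by simp [h0])
  have h2 : ε2 ≠ 0 := fun h0 => hconst (by simp [h0])
  have h3 : ε3 ≠ 0 := fun h0 => hconst (by simp [h0])
  have key : ∀ t x,
      ft x * deriv (fun s => u s x) t
        - deriv (fun y => gt y * At (u t y) * deriv (fun z => u t z) y) x
        - ht x * Bt (u t x) * deriv (fun y => u t y) x
      = ε1 * Real.exp (-ε4 * L x) *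
          (f x * deriv (fun s => u s x) t
            - deriv (fun y => g y * A (u t y) * deriv (fun z => u t z) y) x
            - h x * B (u t x) * deriv (fun y => u t y) x) := by
    intro t x
    have hut : ContDiff ℝ 2 (fun z => u t z) :=
      hu.comp (contDiff_const.prodMk contDiff_id : ContDiff ℝ 2 (fun z : ℝ => (t, z)))
    have hut1 : Differentiable ℝ (fun z => u t z) := hut.differentiable (by norm_num)
    have hdu : Differentiable ℝ (deriv (fun z => u t z)) := by
      have h11 : ContDiff ℝ (1 + 1) (fun z => u t z) := by
        rw [one_add_one_eq_two]; exact hut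
      exact (contDiff_succ_iff_deriv.1 h11).2.2.differentiable (by norm_num)
    have hgd : Differentiable ℝ g := hg.differentiable (by norm_num)
    have hAd : Differentiable ℝ A := hA.differentiable (by norm_num)
    have hLd : Differentiable ℝ L := hL.differentiable (by norm_num)
    have hAu : Differentiable ℝ (fun y => A (u t y)) := hAd.comp hut1
    have hF : DifferentiableAt ℝ
        (fun y => g y * A (u t y) * deriv (fun z => u t z) y) x :=
      ((hgd x).mul (hAu x)).mul (hdu x)
    have hE : HasDerivAt (fun y => ε1 * Real.exp (-ε4 * L y))
        (ε1 * (Real.exp (-ε4 * L x) * (-ε4 * (h x / g x)))) x := by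
      have := (hLd x).hasDerivAt
      rw [hL'] at this
      exact ((this.const_mul (-ε4)).exp).const_mul ε1
    have heq : (fun y => gt y * At (u t y) * deriv (fun z => u t z) y)
        = fun y => (ε1 * Real.exp (-ε4 * L y)) *
          (g y * A (u t y) * deriv (fun z => u t z) y) := by
      funext y
      rw [hgt, hAt]
      field_simp
    have hD := (hE.mul hF.hasDerivAt).deriv
    have hD' : deriv (fun y => gt y * At (u t y) * deriv (fun z => u t z) y) x =
        ε1 * (Real.exp (-ε4 * L x) * (-ε4 * (h x / g x))) *
            (g x * A (u t x) * deriv (fun z => u t z) x) +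
          ε1 * Real.exp (-ε4 * L x) *
            deriv (fun y => g y * A (u t y) * deriv (fun z => u t z) y) x := by
      rw [heq]; exact hD
    rw [hD', hft, hht, hBt]
    have := hg0 x
    generalize deriv (fun y => g y * A (u t y) * deriv (fun z => u t z) y) x = D
    generalize Real.exp (-ε4 * L x) = E
    field_simp
    ring
  refine ⟨key, forall_congr' fun t => forall_congr' fun x => ?_⟩
  have hk := key t x
  have hne : ε1 * Real.exp (-ε4 * L x) ≠ 0 := mul_ne_zero h1 (Real.exp_ne_zero _)
  constructor
  · intro he
    rw [he] at hk
    ring_nf at hk ⊢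
    linarith
  · intro he
    have hz : ε1 * Real.exp (-ε4 * L x) *
          (f x * deriv (fun s => u s x) t
            - deriv (fun y => g y * A (u t y) * deriv (fun z => u t z) y) x
            - h x * B (u t x) * deriv (fun y => u t y) x) = 0 := by
      rw [← hk]; linarith
    have := (mul_eq_zero.1 hz).resolve_left hne
    linarith
end

section
/- Scaling symmetry of the sl(2,ℝ)-invariant equation (case 3.13, generator 2t∂_t + 2x∂_x − 5u∂_u): let λ > 0. If u : ℝ×(0,∞) → (0,∞) is a C² solution of x²·u_t = (u^{−6/5}·u_x)_x + x²·u_x, then the function v(t,x) := λ^{−5}·u(λ^{−2}t, λ^{−2}x), defined for x > 0 (after restricting to the appropriate domain), is also a solution of x²·v_t = (v^{−6/5}·v_x)_x + x²·v_x. -/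
/-- Scaling symmetry of the sl(2,ℝ)-invariant equation
`x² u_t = (u^(−6/5) u_x)_x + x² u_x` (case 3.13): the scaling
`v(t,x) = λ⁻⁵ u(λ⁻² t, λ⁻² x)` maps solutions to solutions. -/
theorem scaling_symmetry_sl2_equation
    (lam : ℝ) (hlam : 0 < lam)
    (u : ℝ → ℝ → ℝ) (hu : ContDiff ℝ 2 (fun p : ℝ × ℝ => u p.1 p.2))
    (hupos : ∀ t x, 0 < x → 0 < u t x)
    (hsol : ∀ t x, 0 < x →
      x ^ 2 * deriv (fun s => u s x) t =
        deriv (fun y => u t y ^ (-(6 : ℝ) / 5) * deriv (fun z => u t z) y) x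
          + x ^ 2 * deriv (fun y => u t y) x)
    (v : ℝ → ℝ → ℝ)
    (hv : ∀ t x, v t x = (lam ^ 5)⁻¹ * u ((lam ^ 2)⁻¹ * t) ((lam ^ 2)⁻¹ * x)) :
    ∀ t x, 0 < x →
      x ^ 2 * deriv (fun s => v s x) t =
        deriv (fun y => v t y ^ (-(6 : ℝ) / 5) * deriv (fun z => v t z) y) x
          + x ^ 2 * deriv (fun y => v t y) x := by
  intro t x hx
  have hk : (0 : ℝ) < (lam ^ 2)⁻¹ := by positivity
  have hc : (0 : ℝ) < (lam ^ 5)⁻¹ := by positivity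
  have hX : 0 < (lam ^ 2)⁻¹ * x := mul_pos hk hx
  have hS := hsol ((lam ^ 2)⁻¹ * t) ((lam ^ 2)⁻¹ * x) hX
  have hvt : deriv (fun s => v s x) t = (lam ^ 5)⁻¹ * ((lam ^ 2)⁻¹ *
      deriv (fun s => u s ((lam ^ 2)⁻¹ * x)) ((lam ^ 2)⁻¹ * t)) := by
    simp only [hv]
    rw [deriv_const_mul_field]
    congr 1
    exact deriv_comp_mul_left (lam ^ 2)⁻¹ (fun s => u s ((lam ^ 2)⁻¹ * x)) t
  have hvx : ∀ y, deriv (fun z => v t z) y = (lam ^ 5)⁻¹ * ((lam ^ 2)⁻¹ *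
      deriv (fun z => u ((lam ^ 2)⁻¹ * t) z) ((lam ^ 2)⁻¹ * y)) := by
    intro y
    simp only [hv]
    rw [deriv_const_mul_field]
    congr 1
    exact deriv_comp_mul_left (lam ^ 2)⁻¹ (fun z => u ((lam ^ 2)⁻¹ * t) z) y
  have hpow : ((lam ^ 5)⁻¹ : ℝ) ^ (-(6 : ℝ) / 5) = lam ^ 6 := by
    rw [← Real.rpow_natCast, ← Real.rpow_neg hlam.le, ← Real.rpow_mul hlam.le,
      ← Real.rpow_natCast]
    norm_num
  have hflux : deriv (fun y => v t y ^ (-(6 : ℝ) / 5) * deriv (fun z => v t z) y) x =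
      (lam ^ 6 * (lam ^ 5)⁻¹ * (lam ^ 2)⁻¹) * ((lam ^ 2)⁻¹ *
        deriv (fun y => u ((lam ^ 2)⁻¹ * t) y ^ (-(6 : ℝ) / 5) *
          deriv (fun z => u ((lam ^ 2)⁻¹ * t) z) y) ((lam ^ 2)⁻¹ * x)) := by
    have hev : (fun y => v t y ^ (-(6 : ℝ) / 5) * deriv (fun z => v t z) y) =ᶠ[nhds x]
        (fun y => (lam ^ 6 * (lam ^ 5)⁻¹ * (lam ^ 2)⁻¹) *
          (fun y => u ((lam ^ 2)⁻¹ * t) y ^ (-(6 : ℝ) / 5) *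
            deriv (fun z => u ((lam ^ 2)⁻¹ * t) z) y) ((lam ^ 2)⁻¹ * y)) := by
      filter_upwards [lt_mem_nhds hx] with y hy
      rw [hvx, hv, Real.mul_rpow hc.le (hupos _ _ (mul_pos hk hy)).le, hpow]
      ring
    rw [hev.deriv_eq, deriv_const_mul_field]
    congr 1
    exact deriv_comp_mul_left (lam ^ 2)⁻¹ (fun y => u ((lam ^ 2)⁻¹ * t) y ^ (-(6 : ℝ) / 5) *
            deriv (fun z => u ((lam ^ 2)⁻¹ * t) z) y) x
  rw [hvt, hvx, hflux]
  generalize deriv (fun y => u ((lam ^ 2)⁻¹ * t) y ^ (-(6 : ℝ) / 5) *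
          deriv (fun z => u ((lam ^ 2)⁻¹ * t) z) y) ((lam ^ 2)⁻¹ * x) = F at *
  generalize deriv (fun z => u ((lam ^ 2)⁻¹ * t) z) ((lam ^ 2)⁻¹ * x) = D at *
  generalize deriv (fun s => u s ((lam ^ 2)⁻¹ * x)) ((lam ^ 2)⁻¹ * t) = T at *
  have hF : F = ((lam ^ 2)⁻¹ * x) ^ 2 * T - ((lam ^ 2)⁻¹ * x) ^ 2 * D := by linarith
  rw [hF]
  field_simp
  ring
end

section
/- Additional equivalence transformation 4 of Table 1 (case 1.4b is mapped to case 1.4a): let A : ℝ → ℝ be C¹. If u : ℝ×ℝ → ℝ is a C² solution of u_t = (A(u)u_x)_x + x·u_x, then the function v : (0,∞)×ℝ → ℝ defined by v(s,y) := u( (1/2)·ln(2s), y/√(2s) ) is a solution of v_s = (A(v)v_y)_y for s > 0. Equivalently, the C² function v determined by v(e^{2t}/2, x·e^{t}) = u(t,x) solves the diffusion equation without convection. -/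
/-- Additional equivalence transformation 4 of Table 1: the map
`v(s,y) = u((1/2)·ln(2s), y/√(2s))` (equivalently `v(e^{2t}/2, x e^t) = u(t,x)`)
sends solutions of `u_t = (A(u)u_x)_x + x u_x` to solutions of `v_s = (A(v)v_y)_y`
for `s > 0`. -/
theorem additional_equivalence_table1_case4b
    (A : ℝ → ℝ) (hA : ContDiff ℝ 1 A)
    (u : ℝ → ℝ → ℝ) (hu : ContDiff ℝ 2 (fun p : ℝ × ℝ => u p.1 p.2))
    (hsol : ∀ t x,
      deriv (fun s => u s x) t =
        deriv (fun y => A (u t y) * deriv (fun z => u t z) y) x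
          + x * deriv (fun y => u t y) x)
    (v : ℝ → ℝ → ℝ)
    (hv : ∀ s y, 0 < s → v s y = u (Real.log (2 * s) / 2) (y / Real.sqrt (2 * s)))
    (hv' : ∀ t x, v (Real.exp (2 * t) / 2) (x * Real.exp t) = u t x) :
    ∀ s y, 0 < s →
      deriv (fun s' => v s' y) s =
        deriv (fun z => A (v s z) * deriv (fun w => v s w) z) y := by
  intro s y hs
  have h2s : 0 < 2 * s := by linarith
  set r := Real.sqrt (2 * s) with hr
  have hr0 : 0 < r := Real.sqrt_pos.mpr h2s
  have hrsq : r ^ 2 = 2 * s := Real.sq_sqrt h2s.le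
  set t := Real.log (2 * s) / 2 with ht
  set x := y / r with hx
  -- right-hand side
  have hvs : ∀ z, v s z = u t (r⁻¹ * z) := by
    intro z
    rw [hv s z hs, ← hr, ← ht, div_eq_inv_mul]
  have hR : deriv (fun z => A (v s z) * deriv (fun w => v s w) z) y
      = r⁻¹ * (r⁻¹ * deriv (fun y => A (u t y) * deriv (fun z => u t z) y) x) := by
    have e1 : (fun z => A (v s z) * deriv (fun w => v s w) z)
        = fun z => r⁻¹ * (fun y => A (u t y) * deriv (fun z => u t z) y) (r⁻¹ * z) := by
      funext z
      have e2 : (fun w => v s w) = fun w => (fun q => u t q) (r⁻¹ * w) := funext hvs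
      rw [e2, deriv_comp_mul_left r⁻¹ (fun q => u t q) z, hvs z, smul_eq_mul]
      ring
    rw [e1, deriv_const_mul_field,
      deriv_comp_mul_left r⁻¹ (fun y => A (u t y) * deriv (fun z => u t z) y) y, smul_eq_mul,
      hx, div_eq_inv_mul]
  -- left-hand side
  have hd : DifferentiableAt ℝ (fun p : ℝ × ℝ => u p.1 p.2) (t, x) :=
    (hu.differentiable (by norm_num)) _
  obtain ⟨L, hL⟩ := hd
  have hut : HasDerivAt (fun a => u a x) (L (1, 0)) t := by
    have h := hL.comp_hasDerivAt t ((hasDerivAt_id t).prodMk (hasDerivAt_const t x))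
    exact h
  have hux : HasDerivAt (fun b => u t b) (L (0, 1)) x := by
    have h := hL.comp_hasDerivAt x ((hasDerivAt_const x t).prodMk (hasDerivAt_id x))
    exact h
  have h2 : HasDerivAt (fun a : ℝ => 2 * a) 2 s := by
    simpa using (hasDerivAt_id s).const_mul (2 : ℝ)
  have hlog := (h2.log h2s.ne').div_const 2
  have hsq := (hasDerivAt_const s y).div (h2.sqrt h2s.ne') hr0.ne'
  have hc := HasFDerivAt.comp_hasDerivAt s
    (f := fun a : ℝ => (Real.log (2 * a) / 2, y / Real.sqrt (2 * a))) hL (hlog.prodMk hsq)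
  have hev : (fun s' => v s' y) =ᶠ[nhds s]
      ((fun p : ℝ × ℝ => u p.1 p.2) ∘
        fun a : ℝ => (Real.log (2 * a) / 2, y / Real.sqrt (2 * a))) := by
    filter_upwards [lt_mem_nhds hs] with a ha
    exact hv a y ha
  have hlin : ∀ a b : ℝ, L (a, b) = a * L (1, 0) + b * L (0, 1) := by
    intro a b
    have : ((a, b) : ℝ × ℝ) = a • ((1, 0) : ℝ × ℝ) + b • ((0, 1) : ℝ × ℝ) := by simp
    rw [this, map_add, map_smul, map_smul, smul_eq_mul, smul_eq_mul]
  have key := hsol t x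
  rw [hut.deriv, hux.deriv] at key
  rw [hR, hev.deriv_eq, hc.deriv, hlin, key, ← hr, ← hrsq, hx]
  field_simp
  ring
end

section
/- Additional equivalence transformation 8 of Table 3 (case 3.14f is mapped to case 3.14a with μ = −1, fast diffusion): if u : ℝ×ℝ → (0,∞) is a C² solution of e^{x}·u_t = (u^{−1}·u_x)_x, then the function v(t,x) := e^{x}·u(t,x) is a solution of v_t = (v^{−1}·v_x)_x. -/
/-- Additional equivalence transformation 8 of Table 3 (fast diffusion):
`v(t,x) = e^x u(t,x)` maps positive solutions of `e^x u_t = (u⁻¹ u_x)_x`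
to solutions of `v_t = (v⁻¹ v_x)_x`. -/
theorem additional_equivalence_table3_case14f
    (u : ℝ → ℝ → ℝ) (hu : ContDiff ℝ 2 (fun p : ℝ × ℝ => u p.1 p.2))
    (hupos : ∀ t x, 0 < u t x)
    (hsol : ∀ t x,
      Real.exp x * deriv (fun s => u s x) t =
        deriv (fun y => (u t y)⁻¹ * deriv (fun z => u t z) y) x)
    (v : ℝ → ℝ → ℝ) (hv : ∀ t x, v t x = Real.exp x * u t x) :
    ∀ t x,
      deriv (fun s => v s x) t =
        deriv (fun y => (v t y)⁻¹ * deriv (fun z => v t z) y) x := by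
  intro t x
  have hd : ∀ y, DifferentiableAt ℝ (fun z => u t z) y := by
    intro y
    have h1 : Differentiable ℝ (fun p : ℝ × ℝ => u p.1 p.2) :=
      hu.differentiable (by norm_num)
    have h2 : DifferentiableAt ℝ (fun z : ℝ => ((t, z) : ℝ × ℝ)) y := by fun_prop
    exact (h1 (t, y)).comp y h2
  have key : (fun y => (v t y)⁻¹ * deriv (fun z => v t z) y)
      = fun y => 1 + (u t y)⁻¹ * deriv (fun z => u t z) y := by
    funext y
    have hvt : (fun z => v t z) = fun z => Real.exp z * u t z := funext (hv t)
    have hder : deriv (fun z => Real.exp z * u t z) y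
        = Real.exp y * u t y + Real.exp y * deriv (fun z => u t z) y :=
      ((Real.hasDerivAt_exp y).mul (hd y).hasDerivAt).deriv
    rw [hvt, hder, hv]
    have h1 := (hupos t y).ne'
    have h2 := (Real.exp_pos y).ne'
    field_simp
  have hvs : (fun s => v s x) = fun s => Real.exp x * u s x := funext fun s => hv s x
  rw [key, hvs, deriv_const_add, deriv_const_mul_field, hsol]
end
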